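/- Let u, v : ℝ² → ℂ be twice continuously differentiable functions of (x,t). Then (u,v) satisfies the MT system if and only if for every z ∈ ℂ∖{0} and every (x,t) ∈ ℝ² the zero-curvature identity ∂_t 𝒰(x,t,z) − ∂_x 𝒱(x,t,z) + (i/4)(z−z⁻¹)[σ₃, 𝒱(x,t,z)] − (i/4)(z+z⁻¹)[σ₃, 𝒰(x,t,z)] + [𝒰(x,t,z), 𝒱(x,t,z)] = 0 holds. (This identity is exactly the compatibility condition of the z-Lax pair.) -/

import Mathlib

open Complex Matrix

noncomputable section

abbrev M2 : Type := Matrix (Fin 2) (Fin 2) ℂ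

/-- partial derivative in `x` (first coordinate). -/
def pdx (f : ℝ × ℝ → ℂ) (p : ℝ × ℝ) : ℂ := fderiv ℝ f p (1, 0)

/-- partial derivative in `t` (second coordinate). -/
def pdt (f : ℝ × ℝ → ℂ) (p : ℝ × ℝ) : ℂ := fderiv ℝ f p (0, 1)

/-- entrywise partial derivative in `x` of a matrix-valued function. -/
def Mdx (M : ℝ × ℝ → M2) (p : ℝ × ℝ) : M2 := Matrix.of fun i j => pdx (fun q => M q i j) p

/-- entrywise partial derivative in `t` of a matrix-valued function. -/
def Mdt (M : ℝ × ℝ → M2) (p : ℝ × ℝ) : M2 := Matrix.of fun i j => pdt (fun q => M q i j) p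

def sigma3 : M2 := !![1, 0; 0, -1]

/-- matrix commutator. -/
def mcomm (A B : M2) : M2 := A * B - B * A

/-- `|w|²` as a complex number. -/
def nsq (w : ℂ) : ℂ := (Complex.normSq w : ℂ)

/-- complex conjugation. -/
def cj (w : ℂ) : ℂ := (starRingEnd ℂ) w

/-- the massive Thirring system. -/
def MTsys (u v : ℝ × ℝ → ℂ) : Prop :=
  ∀ p : ℝ × ℝ,
    Complex.I * (pdt u p + pdx u p) + v p + nsq (v p) * u p = 0 ∧
    Complex.I * (pdt v p - pdx v p) + u p + nsq (u p) * v p = 0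

def cU1m (u v : ℝ × ℝ → ℂ) (p : ℝ × ℝ) : M2 :=
  !![(Complex.I/4) * (nsq (u p) + nsq (v p)), -(Complex.I/2) * cj (v p);
     pdx v p + (Complex.I/2) * nsq (u p) * v p + (Complex.I/2) * u p,
     -((Complex.I/4) * (nsq (u p) + nsq (v p)))]

def cU2m (u v : ℝ × ℝ → ℂ) (p : ℝ × ℝ) : M2 :=
  !![cj (u p) * v p, -cj (u p);
     v p + cj (u p) * (v p)^2, -(cj (u p) * v p)]

def cV1m (u v : ℝ × ℝ → ℂ) (p : ℝ × ℝ) : M2 :=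
  !![-(Complex.I/4) * (nsq (u p) - nsq (v p)), -(Complex.I/2) * cj (v p);
     pdt v p - (Complex.I/2) * nsq (u p) * v p - (Complex.I/2) * u p,
     (Complex.I/4) * (nsq (u p) - nsq (v p))]

/-- the matrix `𝒰(x,t,z)` of the z-Lax pair. -/
def cUmat (u v : ℝ × ℝ → ℂ) (z : ℂ) (p : ℝ × ℝ) : M2 :=
  cU1m u v p - (Complex.I/(2*z)) • cU2m u v p

/-- the matrix `𝒱(x,t,z)` of the z-Lax pair. -/
def cVmat (u v : ℝ × ℝ → ℂ) (z : ℂ) (p : ℝ × ℝ) : M2 :=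
  cV1m u v p + (Complex.I/(2*z)) • cU2m u v p

def HD (e : ℝ × ℝ) (p : ℝ × ℝ) (f : ℝ × ℝ → ℂ) (f' : ℂ) : Prop :=
  DifferentiableAt ℝ f p ∧ fderiv ℝ f p e = f'

lemma HD.add {e p f g a b} (hf : HD e p f a) (hg : HD e p g b) :
    HD e p (fun q => f q + g q) (a + b) := by
  refine ⟨hf.1.add hg.1, ?_⟩
  rw [fderiv_fun_add hf.1 hg.1]; simp [hf.2, hg.2]

lemma HD.sub {e p f g a b} (hf : HD e p f a) (hg : HD e p g b) :
    HD e p (fun q => f q - g q) (a - b) := by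
  refine ⟨hf.1.sub hg.1, ?_⟩
  rw [fderiv_fun_sub hf.1 hg.1]; simp [hf.2, hg.2]

lemma HD.neg {e p f a} (hf : HD e p f a) :
    HD e p (fun q => - f q) (-a) := by
  refine ⟨hf.1.neg, ?_⟩
  rw [fderiv_fun_neg]; simp [hf.2]

lemma HD.mul {e p f g a b} (hf : HD e p f a) (hg : HD e p g b) :
    HD e p (fun q => f q * g q) (a * g p + f p * b) := by
  refine ⟨hf.1.mul hg.1, ?_⟩
  rw [fderiv_fun_mul hf.1 hg.1]; simp [hf.2, hg.2]; ring

lemma HD.cmul {e p f a} (c : ℂ) (hf : HD e p f a) :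
    HD e p (fun q => c * f q) (c * a) := by
  refine ⟨hf.1.const_mul c, ?_⟩
  rw [fderiv_const_mul hf.1]; simp [hf.2]

lemma HD.cj {e p f a} (hf : HD e p f a) :
    HD e p (fun q => cj (f q)) (cj a) := by
  have h := (Complex.conjCLE : ℂ ≃L[ℝ] ℂ).hasFDerivAt.comp p hf.1.hasFDerivAt
  have h' : HasFDerivAt (fun q => _root_.cj (f q)) _ p := h
  refine ⟨h'.differentiableAt, ?_⟩
  rw [h'.fderiv]; simp [hf.2, _root_.cj]

lemma nsq_eq (w : ℂ) : nsq w = w * cj w := by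
  simp [nsq, cj, Complex.mul_conj]

section
variable (u v : ℝ × ℝ → ℂ)

/-- derivative of `𝒰` or `𝒱` in direction e, in terms of entries. -/
lemma entries_d {u v vd : ℝ × ℝ → ℂ} {e p : ℝ × ℝ} {u' v' vd' : ℂ} (z s : ℂ)
    (hu : HD e p u u') (hv : HD e p v v') (hd : HD e p vd vd') :
    HD e p (fun q => (I/4) * (s * (u q * cj (u q)) + v q * cj (v q)) - s * (I/(2*z)) * (cj (u q) * v q))
      ((I/4) * (s * (u' * cj (u p) + u p * cj u') + (v' * cj (v p) + v p * cj v'))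
        - s * (I/(2*z)) * (cj u' * v p + cj (u p) * v')) ∧
    HD e p (fun q => -(I/2) * cj (v q) + s * (I/(2*z)) * cj (u q))
      (-(I/2) * cj v' + s * (I/(2*z)) * cj u') ∧
    HD e p (fun q => vd q + (s * (I/2)) * (u q * cj (u q) * v q + u q)
        - s * (I/(2*z)) * (v q + cj (u q) * (v q * v q)))
      (vd' + (s * (I/2)) * ((u' * cj (u p) + u p * cj u') * v p + u p * cj (u p) * v' + u')
        - s * (I/(2*z)) * (v' + (cj u' * (v p * v p) + cj (u p) * (v' * v p + v p * v')))) := by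
  refine ⟨?_, ?_, ?_⟩
  · exact ((((hu.mul hu.cj).cmul s).add (hv.mul hv.cj)).cmul _).sub ((hu.cj.mul hv).cmul _)
  · exact (hv.cj.cmul _).add (hu.cj.cmul _)
  · exact (hd.add ((((hu.mul hu.cj).mul hv).add hu).cmul _)).sub
      ((hv.add (hu.cj.mul (hv.mul hv))).cmul _)
end

theorem mt_iff_zero_curvature_z
    (u v : ℝ × ℝ → ℂ) (hu : ContDiff ℝ 2 u) (hv : ContDiff ℝ 2 v) :
    MTsys u v ↔
      ∀ z : ℂ, z ≠ 0 → ∀ p : ℝ × ℝ,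
        Mdt (cUmat u v z) p - Mdx (cVmat u v z) p
          + (Complex.I / 4 * (z - z⁻¹)) • mcomm sigma3 (cVmat u v z p)
          - (Complex.I / 4 * (z + z⁻¹)) • mcomm sigma3 (cUmat u v z p)
          + mcomm (cUmat u v z p) (cVmat u v z p) = 0 := by
  have du : Differentiable ℝ u := hu.differentiable (by norm_num)
  have dv : Differentiable ℝ v := hv.differentiable (by norm_num)
  have d2v : Differentiable ℝ (fderiv ℝ v) :=
    (hv.fderiv_right (m := 1) (by norm_num)).differentiable (by norm_num)
  have d2 : ∀ (a : ℝ × ℝ) p e, HD e p (fun q => fderiv ℝ v q a) (fderiv ℝ (fderiv ℝ v) p e a) := by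
    intro a p e
    refine ⟨(d2v p).clm_apply (differentiableAt_const a), ?_⟩
    rw [fderiv_clm_apply (d2v p) (differentiableAt_const a)]
    simp
  have key : ∀ p : ℝ × ℝ, ∃ m : ℂ, ∀ z : ℂ,
      Mdt (cUmat u v z) p = !![
        (I/4) * ((pdt u p * cj (u p) + u p * cj (pdt u p)) + (pdt v p * cj (v p) + v p * cj (pdt v p)))
          - (I/(2*z)) * (cj (pdt u p) * v p + cj (u p) * pdt v p),
        -(I/2) * cj (pdt v p) + (I/(2*z)) * cj (pdt u p);
        m + (I/2) * ((pdt u p * cj (u p) + u p * cj (pdt u p)) * v p + u p * cj (u p) * pdt v p + pdt u p)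
          - (I/(2*z)) * (pdt v p + (cj (pdt u p) * (v p * v p) + cj (u p) * (pdt v p * v p + v p * pdt v p))),
        -((I/4) * ((pdt u p * cj (u p) + u p * cj (pdt u p)) + (pdt v p * cj (v p) + v p * cj (pdt v p)))
          - (I/(2*z)) * (cj (pdt u p) * v p + cj (u p) * pdt v p))] ∧
      Mdx (cVmat u v z) p = !![
        (I/4) * (-(pdx u p * cj (u p) + u p * cj (pdx u p)) + (pdx v p * cj (v p) + v p * cj (pdx v p)))
          + (I/(2*z)) * (cj (pdx u p) * v p + cj (u p) * pdx v p),
        -(I/2) * cj (pdx v p) - (I/(2*z)) * cj (pdx u p);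
        m - (I/2) * ((pdx u p * cj (u p) + u p * cj (pdx u p)) * v p + u p * cj (u p) * pdx v p + pdx u p)
          + (I/(2*z)) * (pdx v p + (cj (pdx u p) * (v p * v p) + cj (u p) * (pdx v p * v p + v p * pdx v p))),
        -((I/4) * (-(pdx u p * cj (u p) + u p * cj (pdx u p)) + (pdx v p * cj (v p) + v p * cj (pdx v p)))
          + (I/(2*z)) * (cj (pdx u p) * v p + cj (u p) * pdx v p))] := by
    intro p
    have hsym : fderiv ℝ (fderiv ℝ v) p (0,1) (1,0) = fderiv ℝ (fderiv ℝ v) p (1,0) (0,1) :=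
      (hv.contDiffAt.isSymmSndFDerivAt (by simp)) _ _
    refine ⟨fderiv ℝ (fderiv ℝ v) p (0,1) (1,0), fun z => ⟨?_, ?_⟩⟩
    · obtain ⟨h1, h2, h3⟩ := entries_d z 1 (e := (0,1)) (p := p) ⟨du p, rfl⟩ ⟨dv p, rfl⟩ (d2 (1,0) p (0,1))
      have h4 := h1.neg
      ext i j
      fin_cases i <;> fin_cases j
      · refine Eq.trans ?_ (h1.2.trans ?_)
        · simp only [Mdt, pdt, Matrix.of_apply]
          congr 2; funext q
          simp [cUmat, cU1m, cU2m, nsq_eq]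
        · simp [pdt]
      · refine Eq.trans ?_ (h2.2.trans ?_)
        · simp only [Mdt, pdt, Matrix.of_apply]
          congr 2; funext q
          simp [cUmat, cU1m, cU2m, nsq_eq]
        · simp [pdt]
      · refine Eq.trans ?_ (h3.2.trans ?_)
        · simp only [Mdt, pdt, Matrix.of_apply]
          congr 2; funext q
          simp [cUmat, cU1m, cU2m, nsq_eq, pdx]; ring
        · simp [pdt]
      · refine Eq.trans ?_ (h4.2.trans ?_)
        · simp only [Mdt, pdt, Matrix.of_apply]
          congr 2; funext q
          simp [cUmat, cU1m, cU2m, nsq_eq]; ring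
        · simp [pdt]
    · rw [hsym]
      obtain ⟨h1, h2, h3⟩ := entries_d z (-1) (e := (1,0)) (p := p) ⟨du p, rfl⟩ ⟨dv p, rfl⟩ (d2 (0,1) p (1,0))
      have h4 := h1.neg
      ext i j
      fin_cases i <;> fin_cases j
      · refine Eq.trans ?_ (h1.2.trans ?_)
        · simp only [Mdx, pdx, Matrix.of_apply]
          congr 2; funext q
          simp [cVmat, cV1m, cU2m, nsq_eq]; ring
        · simp [pdx]
      · refine Eq.trans ?_ (h2.2.trans ?_)
        · simp only [Mdx, pdx, Matrix.of_apply]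
          congr 2; funext q
          simp [cVmat, cV1m, cU2m, nsq_eq]; try ring
        · simp [pdx]; try ring
      · refine Eq.trans ?_ (h3.2.trans ?_)
        · simp only [Mdx, pdx, Matrix.of_apply]
          congr 2; funext q
          simp [cVmat, cV1m, cU2m, nsq_eq, pdt]; ring
        · simp [pdx]; try ring
      · refine Eq.trans ?_ (h4.2.trans ?_)
        · simp only [Mdx, pdx, Matrix.of_apply]
          congr 2; funext q
          simp [cVmat, cV1m, cU2m, nsq_eq]; ring
        · simp [pdx]
  have hI := Complex.I_sq
  constructor
  · intro h z hz p
    obtain ⟨m, hm⟩ := key p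
    obtain ⟨e1, e2⟩ := hm z
    rw [e1, e2]
    obtain ⟨a1, a2⟩ := h p
    rw [nsq_eq] at a1 a2
    have b1 : pdt u p = - pdx u p + I * (v p + v p * cj (v p) * u p) := by
      linear_combination (-I) * a1 + (pdt u p + pdx u p) * hI
    have b2 : pdt v p = pdx v p + I * (u p + u p * cj (u p) * v p) := by
      linear_combination (-I) * a2 + (pdt v p - pdx v p) * hI
    have c1 : cj (pdt u p) = - cj (pdx u p) - I * (cj (v p) + v p * cj (v p) * cj (u p)) := by
      rw [b1]; simp [cj]; ring
    have c2 : cj (pdt v p) = cj (pdx v p) - I * (cj (u p) + u p * cj (u p) * cj (v p)) := by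
      rw [b2]; simp [cj]; ring
    have hw : I/(2*z) = I/2 * z⁻¹ := by field_simp
    have hzw : z * z⁻¹ = 1 := mul_inv_cancel₀ hz
    simp only [cUmat, cVmat, cU1m, cU2m, cV1m, nsq_eq, hw, c1, c2]
    simp only [b1, b2]
    generalize z⁻¹ = w at *
    generalize cj (pdx u p) = ax at *
    generalize cj (pdx v p) = bx at *
    generalize pdx u p = ux at *
    generalize pdx v p = vx at *
    generalize cj (u p) = a at *
    generalize cj (v p) = b at *
    generalize u p = U at *
    generalize v p = V at *
    clear * - hI hzw
    ext i j
    fin_cases i <;> fin_cases j <;>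
      simp [mcomm, sigma3, Matrix.mul_apply, Fin.sum_univ_two]
    all_goals grind
  · intro h p
    have E1 := h 1 one_ne_zero p
    have E2 := h (-1) (by norm_num) p
    have E3 := h 2 (by norm_num) p
    obtain ⟨m, hm⟩ := key p
    rw [(hm _).1, (hm _).2] at E1
    rw [(hm _).1, (hm _).2] at E2
    rw [(hm _).1, (hm _).2] at E3
    have F1 := congrFun (congrFun E1 0) 1
    have F2 := congrFun (congrFun E2 0) 1
    have G1 := congrFun (congrFun E1 1) 0
    have G2 := congrFun (congrFun E2 1) 0
    have G3 := congrFun (congrFun E3 1) 0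
    clear E1 E2 E3 h hm
    simp [mcomm, sigma3, Matrix.mul_apply, Fin.sum_univ_two, cUmat, cVmat, cU1m, cU2m, cV1m, nsq_eq] at F1 F2 G1 G2 G3
    rw [nsq_eq, nsq_eq]
    constructor
    · have : -I * (cj (pdt u p) + cj (pdx u p)) + cj (v p) + v p * cj (v p) * cj (u p) = 0 := by
        ring_nf at F1 F2 ⊢
        simp only [hI] at F1 F2
        linear_combination F2 - F1
      have := congrArg cj this
      simp [cj] at this ⊢
      linear_combination this
    · ring_nf at G1 G2 G3 ⊢
      simp only [hI, I_pow_three] at G1 G2 G3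
      linear_combination -(4/3) * G3 + G1 + G2/3
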